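/- Suppose that in the max-relaxation iteration the sequences {ρ⁺_n} and {ρ⁻_n} converge to a common limit ρ. Then the normalized norms ‖·‖°_n converge, uniformly on every bounded subset of ℝ^m, to a norm ‖·‖* satisfying ρ·‖x‖* = max_{1≤i≤r} ‖A_i x‖* for all x ∈ ℝ^m; in particular ρ = ρ(𝒜) and ‖·‖* is a Barabanov norm for 𝒜. -/

import Mathlib

open Matrix Filter Topology Bornology Pointwise

/-- `N` is a norm on `ℝ^m`: nonnegative, definite, absolutely homogeneous, subadditive. -/
def IsNorm {m : ℕ} (N : (Fin m → ℝ) → ℝ) : Prop :=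
  (∀ x, 0 ≤ N x) ∧ (∀ x, N x = 0 → x = 0) ∧
    (∀ (t : ℝ) (x), N (t • x) = |t| * N x) ∧ (∀ x y, N (x + y) ≤ N x + N y)

/-- `N` is a seminorm on `ℝ^m`. -/
def IsSeminorm {m : ℕ} (N : (Fin m → ℝ) → ℝ) : Prop :=
  (∀ x, 0 ≤ N x) ∧
    (∀ (t : ℝ) (x), N (t • x) = |t| * N x) ∧ (∀ x y, N (x + y) ≤ N x + N y)

/-- The family `A` is irreducible: the matrices have no common invariant subspace
other than `⊥` and `⊤`. -/
def IsIrreducibleFamily {m r : ℕ} (A : Fin r → Matrix (Fin m) (Fin m) ℝ) : Prop :=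
  ∀ W : Submodule ℝ (Fin m → ℝ), (∀ i, ∀ x ∈ W, (A i).mulVec x ∈ W) → W = ⊥ ∨ W = ⊤

/-- The operator norm of a matrix acting on `ℝ^m` (with its sup norm). -/
noncomputable def matNorm {m : ℕ} (M : Matrix (Fin m) (Fin m) ℝ) : ℝ :=
  ‖LinearMap.toContinuousLinearMap M.mulVecLin‖

/-- The joint spectral radius of the family `A`:
`limsup_n (max over words of length n of the norm of the product)^(1/n)`. -/
noncomputable def jsr {m r : ℕ} (A : Fin r → Matrix (Fin m) (Fin m) ℝ) : ℝ :=
  Filter.atTop.limsup fun n : ℕ =>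
    (⨆ w : Fin n → Fin r, matNorm (List.ofFn fun k => A (w k)).prod) ^ (1 / (n : ℝ))

/-- `maxA A N x = max_i N (A_i x)`. -/
noncomputable def maxA {m r : ℕ} (A : Fin r → Matrix (Fin m) (Fin m) ℝ)
    (N : (Fin m → ℝ) → ℝ) (x : Fin m → ℝ) : ℝ :=
  ⨆ i, N ((A i).mulVec x)

/-- `ρ⁺ = max_{x ≠ 0} (max_i N (A_i x)) / N x`. -/
noncomputable def rhoSup {m r : ℕ} (A : Fin r → Matrix (Fin m) (Fin m) ℝ)
    (N : (Fin m → ℝ) → ℝ) : ℝ :=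
  sSup ((fun x => maxA A N x / N x) '' {x | x ≠ 0})

/-- `ρ⁻ = min_{x ≠ 0} (max_i N (A_i x)) / N x`. -/
noncomputable def rhoInf {m r : ℕ} (A : Fin r → Matrix (Fin m) (Fin m) ℝ)
    (N : (Fin m → ℝ) → ℝ) : ℝ :=
  sInf ((fun x => maxA A N x / N x) '' {x | x ≠ 0})

/-- An averaging function: continuous on positives, `γ t t = t`, and strictly
between `min` and `max` off the diagonal. -/
def IsAveraging (γ : ℝ → ℝ → ℝ) : Prop :=
  ContinuousOn (fun p : ℝ × ℝ => γ p.1 p.2) {p | 0 < p.1 ∧ 0 < p.2} ∧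
    (∀ t, 0 < t → γ t t = t) ∧
    ∀ t s, 0 < t → 0 < s → t ≠ s → min t s < γ t s ∧ γ t s < max t s

/-- The max-relaxation iteration: `‖x‖_{n+1} = max (‖x‖_n, γ_n⁻¹ max_i ‖A_i x‖_n)`
where `γ_n = γ (ρ⁻_n, ρ⁺_n)`. -/
noncomputable def iterN {m r : ℕ} (A : Fin r → Matrix (Fin m) (Fin m) ℝ)
    (γ : ℝ → ℝ → ℝ) (N0 : (Fin m → ℝ) → ℝ) : ℕ → (Fin m → ℝ) → ℝ
  | 0 => N0
  | n + 1 => fun x =>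
      max (iterN A γ N0 n x)
        ((γ (rhoInf A (iterN A γ N0 n)) (rhoSup A (iterN A γ N0 n)))⁻¹ *
          maxA A (iterN A γ N0 n) x)

/-- The normalized norms `‖x‖°_n = ‖x‖_n / ‖e‖_n` of the max-relaxation iteration
(for `n = 0` this equals `‖x‖_0` since `‖e‖_0 = 1`). -/
noncomputable def iterNnorm {m r : ℕ} (A : Fin r → Matrix (Fin m) (Fin m) ℝ)
    (γ : ℝ → ℝ → ℝ) (N0 : (Fin m → ℝ) → ℝ) (e : Fin m → ℝ) (n : ℕ) :
    (Fin m → ℝ) → ℝ :=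
  fun x => iterN A γ N0 n x / iterN A γ N0 n e

/-- `e⁺(N, N') = max_{x ≠ 0} N x / N' x`. -/
noncomputable def ePlus {m : ℕ} (N N' : (Fin m → ℝ) → ℝ) : ℝ :=
  sSup ((fun x => N x / N' x) '' {x | x ≠ 0})

/-- `e⁻(N, N') = min_{x ≠ 0} N x / N' x`. -/
noncomputable def eMinus {m : ℕ} (N N' : (Fin m → ℝ) → ℝ) : ℝ :=
  sInf ((fun x => N x / N' x) '' {x | x ≠ 0})

/-- The eccentricity of the norm `N` with respect to the norm `N'`. -/
noncomputable def ecc {m : ℕ} (N N' : (Fin m → ℝ) → ℝ) : ℝ :=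
  ePlus N N' / eMinus N N'

theorem IsNorm.isSeminorm {m : ℕ} {N : (Fin m → ℝ) → ℝ} (h : IsNorm N) : IsSeminorm N :=
  ⟨h.1, h.2.2⟩

theorem IsSeminorm.map_zero {m : ℕ} {N : (Fin m → ℝ) → ℝ} (h : IsSeminorm N) : N 0 = 0 := by
  simpa using h.2.1 0 0

theorem IsNorm.pos {m : ℕ} {N : (Fin m → ℝ) → ℝ} (h : IsNorm N) {x : Fin m → ℝ} (hx : x ≠ 0) :
    0 < N x :=
  (h.1 x).lt_of_ne fun h0 => hx (h.2.1 x h0.symm)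

theorem IsSeminorm.le_add_sub {m : ℕ} {N : (Fin m → ℝ) → ℝ} (h : IsSeminorm N)
    (x y : Fin m → ℝ) : N x ≤ N y + N (x - y) := by
  simpa using h.2.2 y (x - y)

theorem IsSeminorm.abs_sub_le {m : ℕ} {N : (Fin m → ℝ) → ℝ} (h : IsSeminorm N)
    (x y : Fin m → ℝ) : |N x - N y| ≤ N (x - y) := by
  have h1 := h.le_add_sub x y
  have h2 := h.le_add_sub y x
  have h3 : N (y - x) = N (x - y) := by
    simpa using h.2.1 (-1) (x - y)
  rw [abs_le]
  constructor <;> linarith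

/-- A pointwise bounded family of seminorms on `ℝ^m` is uniformly bounded on the unit ball. -/
theorem IsSeminorm.exists_forall_le_mul_norm {ι : Type*} {m : ℕ} {N : ι → (Fin m → ℝ) → ℝ}
    (h : ∀ k, IsSeminorm (N k)) (hb : ∀ x, ∃ C, ∀ k, N k x ≤ C) :
    ∃ C, 0 < C ∧ ∀ k x, N k x ≤ C * ‖x‖ := by
  choose C hC using fun i : Fin m => hb (Pi.single i 1)
  refine ⟨1 + ∑ i, |C i|, by positivity, fun k x => ?_⟩
  have hx : x = ∑ i, x i • (Pi.single i 1 : Fin m → ℝ) := by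
    simpa using (Pi.basisFun ℝ (Fin m)).sum_repr x |>.symm
  calc N k x = N k (∑ i, x i • (Pi.single i 1 : Fin m → ℝ)) := by rw [← hx]
    _ ≤ ∑ i, N k (x i • (Pi.single i 1 : Fin m → ℝ)) :=
        Finset.le_sum_of_subadditive _ (h k).map_zero.le (h k).2.2 _ _
    _ ≤ ∑ i, |C i| * ‖x‖ := by
        refine Finset.sum_le_sum fun i _ => ?_
        rw [(h k).2.1, mul_comm]
        exact mul_le_mul ((hC i k).trans (le_abs_self _)) (norm_le_pi_norm x i)
          (abs_nonneg _) (abs_nonneg _)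
    _ ≤ (1 + ∑ i, |C i|) * ‖x‖ := by
        rw [← Finset.sum_mul]
        gcongr
        linarith

theorem IsSeminorm.exists_le_mul_norm {m : ℕ} {N : (Fin m → ℝ) → ℝ} (h : IsSeminorm N) :
    ∃ C, 0 < C ∧ ∀ x, N x ≤ C * ‖x‖ := by
  obtain ⟨C, hC, H⟩ := IsSeminorm.exists_forall_le_mul_norm (ι := Unit) (fun _ => h)
    fun x => ⟨N x, fun _ => le_rfl⟩
  exact ⟨C, hC, H ()⟩

theorem IsSeminorm.continuous {m : ℕ} {N : (Fin m → ℝ) → ℝ} (h : IsSeminorm N) :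
    Continuous N := by
  obtain ⟨C, hC, H⟩ := h.exists_le_mul_norm
  refine (LipschitzWith.of_dist_le_mul (K := ⟨C, hC.le⟩) fun x y => ?_).continuous
  rw [Real.dist_eq, dist_eq_norm]
  exact (h.abs_sub_le x y).trans (H _)

theorem IsNorm.exists_mul_norm_le {m : ℕ} {N : (Fin m → ℝ) → ℝ} (h : IsNorm N) :
    ∃ c, 0 < c ∧ ∀ x, c * ‖x‖ ≤ N x := by
  obtain hS | hS := (Metric.sphere (0 : Fin m → ℝ) 1).eq_empty_or_nonempty
  · refine ⟨1, one_pos, fun x => ?_⟩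
    by_cases hx : x = 0
    · simpa [hx] using h.1 0
    · have : ‖x‖⁻¹ • x ∈ Metric.sphere (0 : Fin m → ℝ) 1 := by
        simp [norm_smul, hx]
      simp [hS] at this
  · obtain ⟨y, hy, hmin⟩ := (isCompact_sphere (0 : Fin m → ℝ) 1).exists_isMinOn hS
      h.isSeminorm.continuous.continuousOn
    have hy0 : y ≠ 0 := by
      rintro rfl
      simp at hy
    refine ⟨N y, h.pos hy0, fun x => ?_⟩
    by_cases hx : x = 0
    · simpa [hx] using h.1 0
    · have hmem : ‖x‖⁻¹ • x ∈ Metric.sphere (0 : Fin m → ℝ) 1 := by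
        simp [norm_smul, hx]
      have h1 : N y ≤ N (‖x‖⁻¹ • x) := hmin hmem
      rw [h.2.2.1, abs_of_nonneg (by positivity), inv_mul_eq_div,
        le_div_iff₀ (norm_pos_iff.2 hx)] at h1
      exact h1

section maxA

variable {m r : ℕ} {A : Fin r → Matrix (Fin m) (Fin m) ℝ} {N : (Fin m → ℝ) → ℝ}

theorem le_maxA (A : Fin r → Matrix (Fin m) (Fin m) ℝ) (N : (Fin m → ℝ) → ℝ) (x : Fin m → ℝ)
    (i : Fin r) : N ((A i).mulVec x) ≤ maxA A N x :=
  le_ciSup (f := fun i => N ((A i).mulVec x)) (Set.finite_range _).bddAbove i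

theorem maxA_le [NeZero r] {x : Fin m → ℝ} {b : ℝ} (h : ∀ i, N ((A i).mulVec x) ≤ b) :
    maxA A N x ≤ b :=
  ciSup_le h

theorem exists_eq_maxA [NeZero r] (A : Fin r → Matrix (Fin m) (Fin m) ℝ)
    (N : (Fin m → ℝ) → ℝ) (x : Fin m → ℝ) : ∃ i, N ((A i).mulVec x) = maxA A N x :=
  exists_eq_ciSup_of_finite (f := fun i => N ((A i).mulVec x))

theorem maxA_div (A : Fin r → Matrix (Fin m) (Fin m) ℝ) (N : (Fin m → ℝ) → ℝ) {c : ℝ}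
    (hc : 0 ≤ c) (x : Fin m → ℝ) : maxA A (fun y => N y / c) x = maxA A N x / c := by
  simp only [maxA, div_eq_mul_inv]
  rw [Real.iSup_mul_of_nonneg (inv_nonneg.2 hc)]

theorem maxA_le_mul_maxA [NeZero r] {N' : (Fin m → ℝ) → ℝ} {b : ℝ} (hb : 0 ≤ b)
    (h : ∀ x, N x ≤ b * N' x) (x : Fin m → ℝ) : maxA A N x ≤ b * maxA A N' x :=
  maxA_le fun i => (h _).trans (mul_le_mul_of_nonneg_left (le_maxA A N' x i) hb)

theorem mul_maxA_le_maxA [NeZero r] {N' : (Fin m → ℝ) → ℝ} {a : ℝ}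
    (h : ∀ x, a * N' x ≤ N x) (x : Fin m → ℝ) : a * maxA A N' x ≤ maxA A N x := by
  obtain ⟨i, hi⟩ := exists_eq_maxA A N' x
  rw [← hi]
  exact (h _).trans (le_maxA A N x i)

theorem IsSeminorm.maxA [NeZero r] (A : Fin r → Matrix (Fin m) (Fin m) ℝ) (h : IsSeminorm N) :
    IsSeminorm (maxA A N) := by
  refine ⟨fun x => (h.1 _).trans (le_maxA A N x 0), fun t x => ?_, fun x y => ?_⟩
  · simp only [_root_.maxA, mulVec_smul, h.2.1]
    rw [Real.mul_iSup_of_nonneg (abs_nonneg t)]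
  · refine maxA_le fun i => ?_
    rw [mulVec_add]
    exact (h.2.2 _ _).trans (add_le_add (le_maxA A N x i) (le_maxA A N y i))

theorem IsNorm.maxA [NeZero r] (hm : 2 ≤ m) (hA : IsIrreducibleFamily A) (h : IsNorm N) :
    IsNorm (maxA A N) := by
  have hs := h.isSeminorm.maxA A
  refine ⟨hs.1, fun x hx => ?_, hs.2⟩
  by_contra hx0
  have hz : ∀ i, (A i).mulVec x = 0 := fun i =>
    h.2.1 _ (le_antisymm (hx ▸ le_maxA A N x i) (h.1 _))
  rcases hA (Submodule.span ℝ {x}) fun i y hy => by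
    obtain ⟨t, rfl⟩ := Submodule.mem_span_singleton.1 hy
    simp [mulVec_smul, hz i] with hW | hW
  · exact hx0 (by simpa using hW)
  · have h1 := finrank_span_singleton (K := ℝ) hx0
    rw [hW, finrank_top, Module.finrank_fin_fun] at h1
    omega

theorem maxA_le_rhoSup_mul [NeZero r] (h : IsNorm N) (x : Fin m → ℝ) :
    maxA A N x ≤ rhoSup A N * N x := by
  by_cases hx : x = 0
  · simp [hx, h.isSeminorm.map_zero, (h.isSeminorm.maxA A).map_zero]
  obtain ⟨C, hC, H⟩ := (h.isSeminorm.maxA A).exists_le_mul_norm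
  obtain ⟨c, hc, H'⟩ := h.exists_mul_norm_le
  rw [← div_le_iff₀ (h.pos hx)]
  refine le_csSup ⟨C / c, ?_⟩ ⟨x, hx, rfl⟩
  rintro _ ⟨y, hy, rfl⟩
  rw [div_le_iff₀ (h.pos hy), div_mul_eq_mul_div, le_div_iff₀ hc]
  calc maxA A N y * c ≤ C * ‖y‖ * c := by gcongr; exact H y
    _ = C * (c * ‖y‖) := by ring
    _ ≤ C * N y := by gcongr; exact H' y

theorem rhoInf_mul_le_maxA [NeZero r] (h : IsNorm N) (x : Fin m → ℝ) :
    rhoInf A N * N x ≤ maxA A N x := by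
  by_cases hx : x = 0
  · simp [hx, h.isSeminorm.map_zero, (h.isSeminorm.maxA A).map_zero]
  rw [← le_div_iff₀ (h.pos hx)]
  refine csInf_le ⟨0, ?_⟩ ⟨x, hx, rfl⟩
  rintro _ ⟨y, -, rfl⟩
  exact div_nonneg ((h.isSeminorm.maxA A).1 y) (h.1 y)

theorem rhoInf_pos [NeZero r] (hm : 2 ≤ m) (hA : IsIrreducibleFamily A) (h : IsNorm N) :
    0 < rhoInf A N := by
  obtain ⟨C, hC, H⟩ := h.isSeminorm.exists_le_mul_norm
  obtain ⟨c, hc, H'⟩ := (h.maxA hm hA).exists_mul_norm_le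
  have : NeZero m := ⟨by omega⟩
  refine (div_pos hc hC).trans_le (le_csInf ⟨_, 1, one_ne_zero, rfl⟩ ?_)
  rintro _ ⟨y, hy, rfl⟩
  rw [le_div_iff₀ (h.pos hy), div_mul_eq_mul_div, div_le_iff₀ hC]
  calc c * N y ≤ c * (C * ‖y‖) := by gcongr; exact H y
    _ = c * ‖y‖ * C := by ring
    _ ≤ maxA A N y * C := by gcongr; exact H' y

theorem rhoInf_le_rhoSup [NeZero r] (hm : 2 ≤ m) (h : IsNorm N) :
    rhoInf A N ≤ rhoSup A N := by
  have : NeZero m := ⟨by omega⟩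
  exact le_of_mul_le_mul_right ((rhoInf_mul_le_maxA h 1).trans (maxA_le_rhoSup_mul h 1))
    (h.pos one_ne_zero)

theorem IsNorm.sup_mul [NeZero r] {c : ℝ} (hc : 0 ≤ c) (h : IsNorm N) :
    IsNorm fun x => max (N x) (c * _root_.maxA A N x) := by
  have hs := h.isSeminorm.maxA A
  refine ⟨fun x => (h.1 x).trans (le_max_left _ _), fun x hx => ?_, fun t x => ?_, fun x y => ?_⟩
  · exact h.2.1 x (le_antisymm (hx ▸ le_max_left _ _) (h.1 x))
  · dsimp only
    rw [h.2.2.1, hs.2.1, mul_left_comm, mul_max_of_nonneg _ _ (abs_nonneg t)]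
  · refine max_le ((h.2.2.2 x y).trans (add_le_add (le_max_left _ _) (le_max_left _ _))) ?_
    refine (mul_le_mul_of_nonneg_left (hs.2.2 x y) hc).trans ?_
    rw [mul_add]
    exact add_le_add (le_max_right _ _) (le_max_right _ _)

end maxA

theorem IsAveraging.pos {γ : ℝ → ℝ → ℝ} (hγ : IsAveraging γ) {t s : ℝ} (ht : 0 < t)
    (hs : 0 < s) : 0 < γ t s := by
  by_cases h : t = s
  · rw [← h, hγ.2.1 t ht]
    exact ht
  · exact (lt_min ht hs).trans (hγ.2.2 t s ht hs h).1

/-- The norm of a word of length `n` grows exactly like `ρ ^ n`, so a norm with the Barabanov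
property forces `ρ` to be the joint spectral radius. -/
theorem eq_jsr_of_barabanov {m r : ℕ} [NeZero r] {A : Fin r → Matrix (Fin m) (Fin m) ℝ}
    {N : (Fin m → ℝ) → ℝ} (hN : IsNorm N) {ρ : ℝ} (hρ : 0 < ρ)
    (hB : ∀ x, ρ * N x = maxA A N x) {e : Fin m → ℝ} (he : N e = 1) : ρ = jsr A := by
  have hup : ∀ (n : ℕ) (w : Fin n → Fin r) (x : Fin m → ℝ),
      N ((List.ofFn fun k => A (w k)).prod.mulVec x) ≤ ρ ^ n * N x := by
    intro n
    induction n with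
    | zero => intro w x; simp
    | succ n ih =>
      intro w x
      rw [List.ofFn_succ, List.prod_cons, ← mulVec_mulVec, pow_succ', mul_assoc]
      refine (le_maxA A N _ (w 0)).trans ?_
      rw [← hB]
      exact mul_le_mul_of_nonneg_left (ih (fun k => w k.succ) x) hρ.le
  have hlow : ∀ n : ℕ, ∃ w : Fin n → Fin r,
      N ((List.ofFn fun k => A (w k)).prod.mulVec e) = ρ ^ n := by
    intro n
    induction n with
    | zero => exact ⟨Fin.elim0, by simpa using he⟩
    | succ n ih =>
      obtain ⟨w, hw⟩ := ih
      obtain ⟨i, hi⟩ := exists_eq_maxA A N ((List.ofFn fun k => A (w k)).prod.mulVec e)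
      refine ⟨Fin.cons i w, ?_⟩
      rw [List.ofFn_succ, List.prod_cons, ← mulVec_mulVec]
      simp only [Fin.cons_zero, Fin.cons_succ]
      rw [hi, ← hB, hw, pow_succ']
  obtain ⟨C, hC, HC⟩ := hN.isSeminorm.exists_le_mul_norm
  obtain ⟨c, hc, Hc⟩ := hN.exists_mul_norm_le
  have he0 : 0 < ‖e‖ := by
    rw [norm_pos_iff]
    rintro rfl
    simp [hN.isSeminorm.map_zero] at he
  set u : ℕ → ℝ := fun n => ⨆ w : Fin n → Fin r, matNorm (List.ofFn fun k => A (w k)).prod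
  have hu_up : ∀ n, u n ≤ C / c * ρ ^ n := fun n => by
    refine ciSup_le fun w => ContinuousLinearMap.opNorm_le_bound _ (by positivity) fun x => ?_
    have h1 := (Hc _).trans ((hup n w x).trans
      (mul_le_mul_of_nonneg_left (HC x) (pow_nonneg hρ.le n)))
    rw [div_mul_eq_mul_div, div_mul_eq_mul_div, le_div_iff₀ hc]
    calc _ = c * ‖(List.ofFn fun k => A (w k)).prod.mulVec x‖ := by
          rw [mul_comm]; rfl
      _ ≤ _ := h1.trans_eq (by ring)
  have hu_low : ∀ n, (C * ‖e‖)⁻¹ * ρ ^ n ≤ u n := fun n => by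
    obtain ⟨w, hw⟩ := hlow n
    refine le_trans ?_ (le_ciSup (Set.finite_range _).bddAbove w)
    rw [inv_mul_le_iff₀ (by positivity), ← hw, mul_assoc]
    refine (HC _).trans (mul_le_mul_of_nonneg_left ?_ hC.le)
    rw [mul_comm]
    exact (LinearMap.toContinuousLinearMap
      (List.ofFn fun k => A (w k)).prod.mulVecLin).le_opNorm e
  have hroot : ∀ a : ℝ, 0 < a →
      Tendsto (fun n : ℕ => (a * ρ ^ n) ^ (1 / (n : ℝ))) atTop (𝓝 ρ) := by
    intro a ha
    have h1 : Tendsto (fun n : ℕ => a ^ (1 / (n : ℝ)) * ρ) atTop (𝓝 ρ) := by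
      have h2 := (tendsto_const_nhds (x := a)).rpow tendsto_one_div_atTop_nhds_zero_nat
        (Or.inl ha.ne')
      simpa using h2.mul_const ρ
    refine h1.congr' ?_
    filter_upwards [eventually_ne_atTop 0] with n hn
    rw [Real.mul_rpow ha.le (by positivity), one_div, Real.pow_rpow_inv_natCast hρ.le hn]
  have hlim : Tendsto (fun n : ℕ => u n ^ (1 / (n : ℝ))) atTop (𝓝 ρ) := by
    refine tendsto_of_tendsto_of_tendsto_of_le_of_le (hroot (C * ‖e‖)⁻¹ (by positivity))
      (hroot (C / c) (by positivity)) (fun n => ?_) fun n => ?_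
    · exact Real.rpow_le_rpow (by positivity) (hu_low n) (by positivity)
    · exact Real.rpow_le_rpow (le_trans (by positivity) (hu_low n)) (hu_up n) (by positivity)
  exact hlim.limsup_eq.symm

/-- A Barabanov inequality `N (A i x) ≤ R * N x` passes to the kernel: for an irreducible family,
a nonzero seminorm satisfying it is a norm. -/
theorem IsSeminorm.isNorm_of_irreducible {m r : ℕ} {A : Fin r → Matrix (Fin m) (Fin m) ℝ}
    (hA : IsIrreducibleFamily A) {N : (Fin m → ℝ) → ℝ} (hN : IsSeminorm N) {R : ℝ}
    (hR : ∀ i x, N ((A i).mulVec x) ≤ R * N x) {e : Fin m → ℝ} (he : N e ≠ 0) : IsNorm N := by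
  let W : Submodule ℝ (Fin m → ℝ) :=
    { carrier := {x | N x = 0}
      add_mem' := fun {x y} hx hy => le_antisymm
        ((hN.2.2 x y).trans_eq (by rw [hx.out, hy.out, add_zero])) (hN.1 _)
      zero_mem' := hN.map_zero
      smul_mem' := fun t x hx => (hN.2.1 t x).trans (by rw [hx.out, mul_zero]) }
  refine ⟨hN.1, fun x hx => ?_, hN.2⟩
  rcases hA W fun i x hx => le_antisymm ((hR i x).trans_eq (by
    rw [show N x = 0 from hx, mul_zero])) (hN.1 _) with h | h
  · have : x ∈ W := hx
    rwa [h, Submodule.mem_bot] at this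
  · exact absurd (show e ∈ W by rw [h]; trivial) he

/-- For an irreducible family `A`, seminorms normalized at a nonzero vector and expanded by the
`A i` by a bounded factor are uniformly bounded. -/
theorem IsIrreducibleFamily.exists_forall_le_mul_norm {ι : Type*} {m r : ℕ}
    {A : Fin r → Matrix (Fin m) (Fin m) ℝ} (hA : IsIrreducibleFamily A)
    {N : ι → (Fin m → ℝ) → ℝ} (hN : ∀ k, IsSeminorm (N k)) {R : ℝ} (hR0 : 0 ≤ R)
    (hR : ∀ k i x, N k ((A i).mulVec x) ≤ R * N k x) {e : Fin m → ℝ} (he0 : e ≠ 0)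
    (he : ∀ k, N k e = 1) : ∃ C, 0 < C ∧ ∀ k x, N k x ≤ C * ‖x‖ := by
  let W : Submodule ℝ (Fin m → ℝ) :=
    { carrier := {x | ∃ C, ∀ k, N k x ≤ C}
      add_mem' := by
        rintro x y ⟨C, hC⟩ ⟨D, hD⟩
        exact ⟨C + D, fun k => ((hN k).2.2 x y).trans (add_le_add (hC k) (hD k))⟩
      zero_mem' := ⟨0, fun k => (hN k).map_zero.le⟩
      smul_mem' := by
        rintro t x ⟨C, hC⟩
        exact ⟨|t| * C, fun k => ((hN k).2.1 t x).trans_le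
          (mul_le_mul_of_nonneg_left (hC k) (abs_nonneg t))⟩ }
  have heW : e ∈ W := ⟨1, fun k => (he k).le⟩
  refine IsSeminorm.exists_forall_le_mul_norm hN fun x => ?_
  rcases hA W (by
    rintro i x ⟨C, hC⟩
    exact ⟨R * C, fun k => (hR k i x).trans (mul_le_mul_of_nonneg_left (hC k) hR0)⟩) with h | h
  · rw [h, Submodule.mem_bot] at heW
    exact absurd heW he0
  · exact show x ∈ W by rw [h]; trivial

/-- Uniformly bounded seminorms converging pointwise to a norm converge in ratio. -/
theorem eventually_forall_abs_sub_le {ι : Type*} {l : Filter ι} {m : ℕ}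
    {N : ι → (Fin m → ℝ) → ℝ} (hN : ∀ k, IsSeminorm (N k)) {C : ℝ} (hC : 0 < C)
    (hNC : ∀ k x, N k x ≤ C * ‖x‖) {N' : (Fin m → ℝ) → ℝ} (hN' : IsNorm N')
    (hlim : ∀ x, Tendsto (fun k => N k x) l (𝓝 (N' x))) {ε : ℝ} (hε : 0 < ε) :
    ∀ᶠ k in l, ∀ x, |N k x - N' x| ≤ ε * N' x := by
  obtain ⟨C', hC', HC'⟩ := hN'.isSeminorm.exists_le_mul_norm
  obtain ⟨c, hc, Hc⟩ := hN'.exists_mul_norm_le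
  set δ := ε * c / (C + C' + 1) with hδ
  have hδ0 : 0 < δ := by positivity
  obtain ⟨t, -, htf, ht⟩ := (isCompact_sphere (0 : Fin m → ℝ) 1).finite_cover_balls hδ0
  have hev : ∀ᶠ k in l, ∀ y ∈ t, |N k y - N' y| < δ := by
    rw [htf.eventually_all]
    intro y _
    simpa [Real.dist_eq] using (Metric.tendsto_nhds.1 (hlim y)) δ hδ0
  filter_upwards [hev] with k hk x
  by_cases hx : x = 0
  · simp [hx, (hN k).map_zero, hN'.isSeminorm.map_zero]
  have hxn := norm_pos_iff.2 hx
  have hsphere : ∀ z : Fin m → ℝ, ‖z‖ = 1 → |N k z - N' z| ≤ ε * c := by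
    intro z hz
    obtain ⟨y, hy, hzy⟩ := Set.mem_iUnion₂.1 (ht (show z ∈ _ by simpa using hz))
    rw [mem_ball_iff_norm] at hzy
    have h1 := (hN k).abs_sub_le z y |>.trans (hNC k _)
    have h2 := hN'.isSeminorm.abs_sub_le z y |>.trans (HC' _)
    have h3 : C * ‖z - y‖ ≤ C * δ := by gcongr
    have h4 : C' * ‖z - y‖ ≤ C' * δ := by gcongr
    have h5 : (C + C' + 1) * δ = ε * c := by rw [hδ]; field_simp
    have h6 := hk y hy
    rw [abs_lt] at h6
    rw [abs_le] at *
    constructor <;> nlinarith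
  have h1 := hsphere (‖x‖⁻¹ • x) (by simp [norm_smul, hx])
  rw [(hN k).2.1, hN'.2.2.1, ← mul_sub, abs_mul, abs_abs, abs_of_nonneg (by positivity),
    inv_mul_le_iff₀ hxn] at h1
  calc _ ≤ ‖x‖ * (ε * c) := h1
    _ = ε * (c * ‖x‖) := by ring
    _ ≤ ε * N' x := by gcongr; exact Hc x

/-- If `N'` is a Barabanov norm, one relaxation step rescales two-sided bounds of a norm in terms
of `N'` by a common factor. -/
theorem relaxation_bounds {m r : ℕ} [NeZero r] {A : Fin r → Matrix (Fin m) (Fin m) ℝ}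
    {N N' : (Fin m → ℝ) → ℝ} (hN' : IsNorm N') {ρ a b s g : ℝ} (hB : ∀ x, ρ * N' x = maxA A N' x)
    (hs : 0 < s) (ha : 0 ≤ a) (hb : 0 ≤ b) (hg : 0 ≤ g)
    (h : ∀ x, s * a * N' x ≤ N x ∧ N x ≤ s * b * N' x) (x : Fin m → ℝ) :
    s * max 1 (g * ρ) * a * N' x ≤ max (N x) (g * maxA A N x) ∧
      max (N x) (g * maxA A N x) ≤ s * max 1 (g * ρ) * b * N' x := by
  have key : ∀ d, 0 ≤ d → s * max 1 (g * ρ) * d * N' x =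
      max (s * d * N' x) (g * (s * d * maxA A N' x)) := fun d hd => by
    have h0 : 0 ≤ s * d * N' x := mul_nonneg (mul_nonneg hs.le hd) (hN'.1 x)
    rw [← hB, show s * max 1 (g * ρ) * d * N' x = s * d * N' x * max 1 (g * ρ) by ring,
      mul_max_of_nonneg _ _ h0]
    congr 1 <;> ring
  rw [key a ha, key b hb]
  exact ⟨max_le_max (h x).1 (mul_le_mul_of_nonneg_left (mul_maxA_le_maxA (fun y => (h y).1) x) hg),
    max_le_max (h x).2 (mul_le_mul_of_nonneg_left
      (maxA_le_mul_maxA (mul_nonneg hs.le hb) (fun y => (h y).2) x) hg)⟩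

theorem exists_tendsto_ultrafilter {ι : Type*} (U : Ultrafilter ι) {f : ι → ℝ} {a b : ℝ}
    (h : ∀ k, f k ∈ Set.Icc a b) : ∃ y, Tendsto f U (𝓝 y) := by
  obtain ⟨y, -, hy⟩ := isCompact_Icc.ultrafilter_le_nhds (U.map f)
    (le_principal_iff.2 (Filter.mem_map.2 (Filter.univ_mem' h)))
  exact ⟨y, hy⟩

section iteration

variable {m r : ℕ} [NeZero r] {A : Fin r → Matrix (Fin m) (Fin m) ℝ} {γ : ℝ → ℝ → ℝ}
  {N0 : (Fin m → ℝ) → ℝ}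

theorem gamma_pos (hm : 2 ≤ m) (hA : IsIrreducibleFamily A) (hγ : IsAveraging γ)
    {N : (Fin m → ℝ) → ℝ} (hN : IsNorm N) : 0 < γ (rhoInf A N) (rhoSup A N) :=
  hγ.pos (rhoInf_pos hm hA hN) ((rhoInf_pos hm hA hN).trans_le (rhoInf_le_rhoSup hm hN))

theorem isNorm_iterN (hm : 2 ≤ m) (hA : IsIrreducibleFamily A) (hγ : IsAveraging γ)
    (hN0 : IsNorm N0) (n : ℕ) : IsNorm (iterN A γ N0 n) := by
  induction n with
  | zero => exact hN0
  | succ n ih => exact ih.sup_mul (inv_nonneg.2 (gamma_pos hm hA hγ ih).le)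

/-- Along the iteration, two-sided bounds in terms of a Barabanov norm persist up to scaling. -/
theorem iterN_bounds (hm : 2 ≤ m) (hA : IsIrreducibleFamily A) (hγ : IsAveraging γ)
    (hN0 : IsNorm N0) {N' : (Fin m → ℝ) → ℝ} (hN' : IsNorm N') {ρ a b s : ℝ}
    (hB : ∀ x, ρ * N' x = maxA A N' x) (hs : 0 < s) (ha : 0 ≤ a) (hb : 0 ≤ b) {k : ℕ}
    (h : ∀ x, s * a * N' x ≤ iterN A γ N0 k x ∧ iterN A γ N0 k x ≤ s * b * N' x)
    {n : ℕ} (hn : k ≤ n) :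
    ∃ s, 0 < s ∧ ∀ x, s * a * N' x ≤ iterN A γ N0 n x ∧ iterN A γ N0 n x ≤ s * b * N' x := by
  induction n, hn using Nat.le_induction with
  | base => exact ⟨s, hs, h⟩
  | succ n _ ih =>
    obtain ⟨s, hs, h⟩ := ih
    exact ⟨_, mul_pos hs (lt_max_of_lt_left one_pos), relaxation_bounds hN' hB hs ha hb
      (inv_nonneg.2 (gamma_pos hm hA hγ (isNorm_iterN hm hA hγ hN0 n)).le) h⟩

end iteration

/-- if `{ρ⁺_n}` and `{ρ⁻_n}` converge to a common limit `ρ`, then the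
normalized norms converge uniformly on bounded sets to a norm `‖·‖*` satisfying
`ρ ‖x‖* = max_i ‖A_i x‖*`; in particular `ρ = ρ(𝒜)` and `‖·‖*` is a Barabanov norm. -/
theorem stmt8 {m r : ℕ} (hm : 2 ≤ m) (hr : 1 ≤ r)
    (A : Fin r → Matrix (Fin m) (Fin m) ℝ) (hA : IsIrreducibleFamily A)
    (γ : ℝ → ℝ → ℝ) (hγ : IsAveraging γ)
    (N0 : (Fin m → ℝ) → ℝ) (hN0 : IsNorm N0)
    (e : Fin m → ℝ) (he : N0 e = 1)
    (ρ : ℝ)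
    (hplus : Tendsto (fun n => rhoSup A (iterN A γ N0 n)) atTop (𝓝 ρ))
    (hminus : Tendsto (fun n => rhoInf A (iterN A γ N0 n)) atTop (𝓝 ρ)) :
    ∃ Nstar : (Fin m → ℝ) → ℝ, IsNorm Nstar ∧
      (∀ S : Set (Fin m → ℝ), IsBounded S →
        TendstoUniformlyOn (fun n => iterNnorm A γ N0 e n) Nstar atTop S) ∧
      (∀ x, ρ * Nstar x = maxA A Nstar x) ∧ ρ = jsr A := by
  have : NeZero r := ⟨by omega⟩
  have hNn := isNorm_iterN hm hA hγ hN0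
  have he0 : e ≠ 0 := by
    rintro rfl
    simp [hN0.isSeminorm.map_zero] at he
  have hpos : ∀ n, 0 < iterN A γ N0 n e := fun n => (hNn n).pos he0
  have hM : ∀ n, IsSeminorm (iterNnorm A γ N0 e n) := fun n =>
    ⟨fun x => div_nonneg ((hNn n).1 x) (hpos n).le,
      fun t x => by simp only [iterNnorm, (hNn n).2.2.1, mul_div_assoc],
      fun x y => by
        simp only [iterNnorm, ← add_div]
        exact div_le_div_of_nonneg_right ((hNn n).2.2.2 x y) (hpos n).le⟩
  have hMe : ∀ n, iterNnorm A γ N0 e n e = 1 := fun n => div_self (hpos n).ne'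
  have hMsup : ∀ n x, maxA A (iterNnorm A γ N0 e n) x ≤
      rhoSup A (iterN A γ N0 n) * iterNnorm A γ N0 e n x := fun n x => by
    unfold iterNnorm
    rw [maxA_div A _ (hpos n).le, ← mul_div_assoc]
    exact div_le_div_of_nonneg_right (maxA_le_rhoSup_mul (hNn n) x) (hpos n).le
  have hMinf : ∀ n x, rhoInf A (iterN A γ N0 n) * iterNnorm A γ N0 e n x ≤
      maxA A (iterNnorm A γ N0 e n) x := fun n x => by
    unfold iterNnorm
    rw [maxA_div A _ (hpos n).le, ← mul_div_assoc]
    exact div_le_div_of_nonneg_right (rhoInf_mul_le_maxA (hNn n) x) (hpos n).le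
  obtain ⟨R, hR⟩ := hplus.bddAbove_range
  have hR' : ∀ n, rhoSup A (iterN A γ N0 n) ≤ R := fun n => hR ⟨n, rfl⟩
  have hR0 : 0 ≤ R := ((rhoInf_pos hm hA (hNn 0)).le.trans
    (rhoInf_le_rhoSup hm (hNn 0))).trans (hR' 0)
  obtain ⟨C, hC, HC⟩ := hA.exists_forall_le_mul_norm hM hR0
    (fun n i x => (le_maxA A _ x i).trans ((hMsup n x).trans
      (mul_le_mul_of_nonneg_right (hR' n) ((hM n).1 x)))) he0 hMe
  let U : Ultrafilter ℕ := Ultrafilter.of atTop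
  have hU : (U : Filter ℕ) ≤ atTop := Ultrafilter.of_le _
  choose N' hN'lim using fun x =>
    exists_tendsto_ultrafilter U (f := fun n => iterNnorm A γ N0 e n x)
      (fun n => ⟨(hM n).1 x, HC n x⟩)
  have hN's : IsSeminorm N' :=
    ⟨fun x => ge_of_tendsto' (hN'lim x) fun n => (hM n).1 x,
      fun t x => tendsto_nhds_unique (hN'lim (t • x)) (((hN'lim x).const_mul |t|).congr
        fun n => ((hM n).2.1 t x).symm),
      fun x y => le_of_tendsto_of_tendsto' (hN'lim _) ((hN'lim x).add (hN'lim y))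
        fun n => (hM n).2.2 x y⟩
  have hN'e : N' e = 1 := tendsto_nhds_unique (hN'lim e) (by simp [hMe])
  have hB : ∀ x, ρ * N' x = maxA A N' x := by
    intro x
    apply le_antisymm
    · obtain ⟨i, hi⟩ : ∃ i, ∃ᶠ n in (U : Filter ℕ),
          iterNnorm A γ N0 e n ((A i).mulVec x) = maxA A (iterNnorm A γ N0 e n) x := by
        by_contra! h
        obtain ⟨n, hn⟩ := (eventually_all.2 h).exists
        obtain ⟨i, hi⟩ := exists_eq_maxA A (iterNnorm A γ N0 e n) x
        exact hn i hi
      refine le_trans ?_ (le_maxA A N' x i)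
      refine le_of_tendsto_of_tendsto_of_frequently ((hminus.mono_left hU).mul (hN'lim x))
        (hN'lim ((A i).mulVec x)) (hi.mono fun n hn => ?_)
      rw [hn]
      exact hMinf n x
    · exact maxA_le fun i => le_of_tendsto_of_tendsto' (hN'lim _)
        ((hplus.mono_left hU).mul (hN'lim x)) fun n => (le_maxA A _ x i).trans (hMsup n x)
  have hN' : IsNorm N' := hN's.isNorm_of_irreducible hA
    (fun i x => (le_maxA A N' x i).trans_eq (hB x).symm) (e := e) (by simp [hN'e])
  have hρ : 0 < ρ := by
    have := (hN'.maxA hm hA).pos he0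
    rwa [← hB, hN'e, mul_one] at this
  refine ⟨N', hN', fun S hS => ?_, hB, eq_jsr_of_barabanov hN' hρ hB hN'e⟩
  obtain ⟨K, hK⟩ := hS.exists_norm_le
  obtain ⟨C', hC', HC'⟩ := hN's.exists_le_mul_norm
  rw [Metric.tendstoUniformlyOn_iff]
  intro ε hε
  obtain ⟨δ, hδ0, hδ1, hδ⟩ : ∃ δ : ℝ, 0 < δ ∧ δ ≤ 1 / 2 ∧ 4 * δ * (C' * (|K| + 1)) < ε := by
    refine ⟨min (1 / 2) (ε / (8 * (C' * (|K| + 1)))), by positivity, min_le_left _ _, ?_⟩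
    have h1 := min_le_right (1 / 2) (ε / (8 * (C' * (|K| + 1))))
    rw [le_div_iff₀ (by positivity)] at h1
    linarith
  obtain ⟨k, hk⟩ := (eventually_forall_abs_sub_le hM hC HC hN' hN'lim hδ0).exists
  have hk' : ∀ x, iterN A γ N0 k e * (1 - δ) * N' x ≤ iterN A γ N0 k x ∧
      iterN A γ N0 k x ≤ iterN A γ N0 k e * (1 + δ) * N' x := fun x => by
    have h1 := abs_le.1 (hk x)
    have h2 : iterN A γ N0 k x = iterN A γ N0 k e * iterNnorm A γ N0 e k x :=
      (mul_div_cancel₀ _ (hpos k).ne').symm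
    rw [h2, mul_assoc, mul_assoc]
    constructor <;> refine mul_le_mul_of_nonneg_left ?_ (hpos k).le <;> linarith
  filter_upwards [eventually_ge_atTop k] with n hn x hx
  obtain ⟨s, hs, hsn⟩ := iterN_bounds hm hA hγ hN0 hN' hB (hpos k) (by linarith) (by linarith)
    hk' hn
  have hclose : |iterNnorm A γ N0 e n x - N' x| ≤ 4 * δ * N' x := by
    obtain ⟨hx1, hx2⟩ := hsn x
    obtain ⟨he1, he2⟩ := hsn e
    rw [hN'e, mul_one] at he1 he2
    have h0 := hN'.1 x
    have hsx : 0 ≤ s * N' x := mul_nonneg hs.le h0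
    rw [abs_le, neg_le_sub_iff_le_add, sub_le_iff_le_add, iterNnorm, ← sub_le_iff_le_add,
      le_div_iff₀ (hpos n), div_le_iff₀ (hpos n)]
    constructor
    · have h1 : N' x * iterN A γ N0 n e ≤ N' x * (s * (1 + δ)) := by gcongr
      by_cases h4 : 4 * δ ≤ 1
      · have h2 : (1 - 4 * δ) * (N' x * iterN A γ N0 n e) ≤
            (1 - 4 * δ) * (N' x * (s * (1 + δ))) := by gcongr
        nlinarith [mul_nonneg hsx hδ0.le, mul_nonneg hsx (mul_nonneg hδ0.le hδ0.le)]
      · have h2 : 0 ≤ (4 * δ - 1) * (N' x * iterN A γ N0 n e) :=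
          mul_nonneg (by linarith) (mul_nonneg h0 (hpos n).le)
        have h3 := (hNn n).1 x
        nlinarith
    · have h1 : (4 * δ + 1) * N' x * (s * (1 - δ)) ≤
          (4 * δ + 1) * N' x * iterN A γ N0 n e := by gcongr
      nlinarith [mul_nonneg hsx (mul_nonneg hδ0.le (sub_nonneg.2 hδ1))]
  rw [dist_comm, Real.dist_eq]
  refine hclose.trans_lt (lt_of_le_of_lt ?_ hδ)
  refine mul_le_mul_of_nonneg_left ((HC' x).trans ?_) (by positivity)
  exact mul_le_mul_of_nonneg_left ((hK x hx).trans ((le_abs_self K).trans (by linarith))) hC'.le
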